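/- arXiv:2206.01959 — 2 statements merged into one kernel-verified Lean document; each statement's English description precedes it below -/
import Mathlib

section
/- Define, for η ∈ Ω_N^d and x ∈ 𝕋_N^d, ω_x = (η_x − ϱ_x)/(ϱ_x(K − ϱ_x)), and b_N(x, x+e_i) = K[p_i ϱ_x (K − ϱ_{x+e_i}) − p_{i+d} ϱ_{x+e_i} (K − ϱ_x)] for 1 ≤ i ≤ d, and set E_{N,t} = ∫ { N^{1+κ} Σ_{i=1}^d Σ_{x ∈ 𝕋_N^d} b_N(x, x+e_i)(ω_{x+e_i} − ω_x) − K Σ_{x ∈ 𝕋_N^d} ω_x ∂_t ϱ_x } dμ_{N,t}. Then there exists a constant C, independent of N and of t ∈ [0,T], such that for all sufficiently large N, E_{N,t} ≤ H_N(t) + C N^{d+2κ−2α−2}. -/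
open Real Filter

noncomputable section

/-- The discrete torus `𝕋_N^d`, realized as `d`-tuples of residues mod `N`. -/
abbrev Site (N d : ℕ) := Fin d → Fin N

/-- Configurations of the generalized exclusion process: at most `K` particles per site. -/
abbrev GCfg (N d K : ℕ) := Site N d → Fin (K + 1)

/-- Cyclic successor on `Fin N`. -/
def finCycAdd {N : ℕ} (a : Fin N) : Fin N :=
  ⟨(a.val + 1) % N, Nat.mod_lt _ (Nat.lt_of_le_of_lt (Nat.zero_le _) a.isLt)⟩

/-- Cyclic predecessor on `Fin N`. -/
def finCycSub {N : ℕ} (a : Fin N) : Fin N :=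
  ⟨(a.val + (N - 1)) % N, Nat.mod_lt _ (Nat.lt_of_le_of_lt (Nat.zero_le _) a.isLt)⟩

/-- The neighbour `x + e_i` (if `b = true`) resp. `x − e_i` (if `b = false`) of a site. -/
def siteMove {N d : ℕ} (x : Site N d) (i : Fin d) (b : Bool) : Site N d :=
  Function.update x i (if b then finCycAdd (x i) else finCycSub (x i))

/-- The configuration `η^{x,y}` obtained from `η` when one particle jumps from `x` to `y`. -/
def cfgJump {N d K : ℕ} (η : GCfg N d K) (x y : Site N d) : GCfg N d K := fun z =>
  if z = x then ⟨(η x).val - 1, lt_of_le_of_lt (Nat.sub_le _ _) (η x).isLt⟩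
  else if z = y then ⟨min ((η y).val + 1) K, Nat.lt_succ_of_le (min_le_right _ _)⟩
  else η z

/-- The jump rate `c_{x,i}(η) = p_i η_x (K − η_{x+e_i})`, with directions indexed by
`(i,b) ∈ Fin d × Bool`: `(i,true)` is `e_i` and `(i,false)` is `−e_i = e_{i+d}`. -/
def jumpRate {N d K : ℕ} (p : Fin d → Bool → ℝ) (η : GCfg N d K)
    (x : Site N d) (i : Fin d) (b : Bool) : ℝ :=
  p i b * ((η x).val : ℝ) * ((K : ℝ) - ((η (siteMove x i b)).val : ℝ))

/-- The generator `L_N` of the asymmetric generalized exclusion process. -/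
def genL {N d K : ℕ} (p : Fin d → Bool → ℝ) (f : GCfg N d K → ℝ) (η : GCfg N d K) : ℝ :=
  ∑ i : Fin d, ∑ b : Bool, ∑ x : Site N d,
    jumpRate p η x i b * (f (cfgJump η x (siteMove x i b)) - f η)

/-- The `Binomial (K, ϱ/K)` weight of the occupation number `k`. -/
def binomW (K : ℕ) (ϱ : ℝ) (k : ℕ) : ℝ :=
  (K.choose k : ℝ) * (ϱ / K) ^ k * (1 - ϱ / K) ^ (K - k)

/-- The product measure on configurations with `Binomial (K, ϱ_x/K)` marginals. -/
def prodBinom {N d K : ℕ} (ϱ : Site N d → ℝ) (η : GCfg N d K) : ℝ :=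
  ∏ x : Site N d, binomW K (ϱ x) (η x).val

/-- The relative entropy `H(μ|ν) = Σ_η f(η) log f(η) ν(η)` with `f = μ/ν`. -/
def relEnt {Ω : Type*} [Fintype Ω] (μ ν : Ω → ℝ) : ℝ :=
  ∑ η : Ω, (μ η / ν η) * Real.log (μ η / ν η) * ν η

/-- The Dirichlet form `D_N(f;ν)`. -/
def dirichletForm {N d K : ℕ} (p : Fin d → Bool → ℝ) (f ν : GCfg N d K → ℝ) : ℝ :=
  ∑ i : Fin d, ∑ b : Bool, ∑ x : Site N d, ∑ η : GCfg N d K,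
    jumpRate p η x i b *
      (Real.sqrt (f (cfgJump η x (siteMove x i b))) - Real.sqrt (f η)) ^ 2 * ν η

/-- The macroscopic coordinates `x/N ∈ 𝕋^d` of a site. -/
def siteCoord {N d : ℕ} (x : Site N d) : Fin d → ℝ := fun j => (x j : ℝ) / N

/-- The slowly varying density profile
`ϱ_N(t,u) = ϱ* + N^{−α} ρ(N^{κ−α} t, u − N^κ λ t m)`, with `λ = K − 2ϱ*`. -/
def profileGE (d K : ℕ) (ϱs α κ : ℝ) (m : Fin d → ℝ) (ρ : ℝ → (Fin d → ℝ) → ℝ)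
    (N : ℕ) (t : ℝ) (u : Fin d → ℝ) : ℝ :=
  ϱs + (N : ℝ) ^ (-α) * ρ ((N : ℝ) ^ (κ - α) * t)
    (fun j => u j - (N : ℝ) ^ κ * ((K : ℝ) - 2 * ϱs) * t * m j)

end

lemma sum_mul_le_relEnt_add {Ω : Type*} [Fintype Ω] (μ ν g : Ω → ℝ) (R : ℝ)
    (hμ : ∀ η, 0 ≤ μ η) (hμ1 : ∑ η, μ η = 1) (hν : ∀ η, 0 < ν η)
    (hg : ∑ η, ν η * Real.exp (g η) ≤ Real.exp R) :
    ∑ η, g η * μ η ≤ relEnt μ ν + R := by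
  have key : ∀ η, g η * μ η ≤ (μ η / ν η) * Real.log (μ η / ν η) * ν η + R * μ η
      + (ν η * Real.exp (g η)) * Real.exp (-R) - μ η := by
    intro η
    have hνη := hν η
    rcases (hμ η).eq_or_lt with h0 | hpos
    · simp only [← h0]
      simp only [mul_zero, zero_div, zero_mul, zero_add, sub_zero]
      positivity
    · have h1 := Real.add_one_le_exp (g η - R - Real.log (μ η / ν η))
      have h2 : Real.exp (g η - R - Real.log (μ η / ν η))
          = Real.exp (g η) * Real.exp (-R) * (ν η / μ η) := by
        rw [Real.exp_sub, Real.exp_log (by positivity), sub_eq_add_neg, Real.exp_add]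
        field_simp
      rw [h2] at h1
      have h3 := mul_le_mul_of_nonneg_right h1 hpos.le
      have h4 : Real.exp (g η) * Real.exp (-R) * (ν η / μ η) * μ η
          = (ν η * Real.exp (g η)) * Real.exp (-R) := by
        field_simp
      have h5 : (μ η / ν η) * Real.log (μ η / ν η) * ν η = μ η * Real.log (μ η / ν η) := by
        field_simp
      rw [h5]
      rw [h4] at h3
      linarith
  have hsum := Finset.sum_le_sum (fun η (_ : η ∈ Finset.univ) => key η)
  rw [Finset.sum_sub_distrib, Finset.sum_add_distrib, Finset.sum_add_distrib,
    ← Finset.mul_sum, ← Finset.sum_mul, hμ1] at hsum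
  have h6 : (∑ η, ν η * Real.exp (g η)) * Real.exp (-R) ≤ 1 := by
    calc _ ≤ Real.exp R * Real.exp (-R) :=
          mul_le_mul_of_nonneg_right hg (Real.exp_pos _).le
      _ = 1 := by rw [← Real.exp_add]; simp
  unfold relEnt
  linarith

lemma binomW_eq_eval (K : ℕ) (r : ℝ) (k : ℕ) :
    binomW K r k = (bernsteinPolynomial ℝ K k).eval (r / K) := by
  simp [binomW, bernsteinPolynomial]

lemma sum_binomW (K : ℕ) (r : ℝ) : ∑ k : Fin (K + 1), binomW K r k = 1 := by
  rw [Fin.sum_univ_eq_sum_range (fun k => binomW K r k)]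
  simp only [binomW_eq_eval]
  rw [← Polynomial.eval_finsetSum, bernsteinPolynomial.sum]
  simp

lemma sum_binomW_mul (K : ℕ) (hK : 1 ≤ K) (r : ℝ) :
    ∑ k : Fin (K + 1), binomW K r k * (k.val : ℝ) = r := by
  have hK' : (K : ℝ) ≠ 0 := by positivity
  rw [Fin.sum_univ_eq_sum_range (fun k => binomW K r k * (k : ℝ))]
  have h := congrArg (Polynomial.eval (r / K)) (bernsteinPolynomial.sum_smul ℝ K)
  rw [Polynomial.eval_finsetSum] at h
  simp only [binomW_eq_eval]
  simp only [nsmul_eq_mul, Polynomial.eval_mul, Polynomial.eval_natCast, Polynomial.eval_X] at h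
  rw [mul_div_cancel₀ _ hK'] at h
  exact (Finset.sum_congr rfl fun k _ => mul_comm _ _).trans h

lemma binomW_pos {K : ℕ} {r : ℝ} (h0 : 0 < r) (h1 : r < K) (k : Fin (K + 1)) :
    0 < binomW K r k := by
  have hK : (0 : ℝ) < K := h0.trans h1
  have h2 : 0 < 1 - r / K := by
    rw [sub_pos, div_lt_one hK]
    exact h1
  have h3 : (0 : ℝ) < K.choose k := by
    exact_mod_cast Nat.choose_pos (Nat.lt_succ_iff.mp k.isLt)
  unfold binomW
  positivity

lemma sum_binomW_mul_exp_le {K : ℕ} (hK : 1 ≤ K) {r : ℝ} (h0 : 0 < r) (h1 : r < K)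
    (a c : ℝ) (hc : |a| * K ≤ c) (hc1 : c ≤ 1) :
    ∑ k : Fin (K + 1), binomW K r k * Real.exp (a * ((k.val : ℝ) - r)) ≤ Real.exp (c ^ 2) := by
  have key : ∀ k : Fin (K + 1), binomW K r k * Real.exp (a * ((k.val : ℝ) - r))
      ≤ binomW K r k * (1 + c ^ 2) + a * (binomW K r k * (k.val : ℝ) - r * binomW K r k) := by
    intro k
    have hw := (binomW_pos h0 h1 k).le
    have hk : (k.val : ℝ) ≤ K := by exact_mod_cast Nat.lt_succ_iff.mp k.isLt
    have hk0 : (0 : ℝ) ≤ k.val := by positivity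
    have h2 : |a * ((k.val : ℝ) - r)| ≤ c := by
      rw [abs_mul]
      refine (mul_le_mul_of_nonneg_left ?_ (abs_nonneg a)).trans hc
      rw [abs_le]
      constructor <;> linarith
    have h3 := (abs_le.mp (Real.abs_exp_sub_one_sub_id_le (h2.trans hc1))).2
    have h4 : (a * ((k.val : ℝ) - r)) ^ 2 ≤ c ^ 2 := sq_le_sq' (abs_le.mp h2).1 (abs_le.mp h2).2
    have h5 : Real.exp (a * ((k.val : ℝ) - r)) ≤ 1 + c ^ 2 + a * ((k.val : ℝ) - r) := by linarith
    calc _ ≤ binomW K r k * (1 + c ^ 2 + a * ((k.val : ℝ) - r)) :=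
          mul_le_mul_of_nonneg_left h5 hw
      _ = _ := by ring
  refine (Finset.sum_le_sum fun k _ => key k).trans ?_
  rw [Finset.sum_add_distrib, ← Finset.sum_mul, ← Finset.mul_sum, Finset.sum_sub_distrib,
    ← Finset.mul_sum, sum_binomW, sum_binomW_mul K hK]
  have := Real.add_one_le_exp (c ^ 2)
  linarith

lemma sum_prodBinom_mul_exp_le {N d K : ℕ} (hK : 1 ≤ K) (r : Site N d → ℝ)
    (h0 : ∀ x, 0 < r x) (h1 : ∀ x, r x < K) (a : Site N d → ℝ) (c : ℝ)
    (hc : ∀ x, |a x| * K ≤ c) (hc1 : c ≤ 1) :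
    ∑ η : GCfg N d K, prodBinom r η * Real.exp (∑ x, a x * (((η x).val : ℝ) - r x))
      ≤ Real.exp ((N : ℝ) ^ d * c ^ 2) := by
  have h2 : ∀ η : GCfg N d K,
      prodBinom r η * Real.exp (∑ x, a x * (((η x).val : ℝ) - r x))
      = ∏ x, binomW K (r x) (η x) * Real.exp (a x * (((η x).val : ℝ) - r x)) := by
    intro η
    rw [Real.exp_sum, prodBinom, ← Finset.prod_mul_distrib]
  rw [Finset.sum_congr rfl fun η _ => h2 η,
    ← Fintype.prod_sum fun x (k : Fin (K + 1)) =>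
      binomW K (r x) k * Real.exp (a x * ((k.val : ℝ) - r x))]
  calc _ ≤ ∏ _x : Site N d, Real.exp (c ^ 2) := by
        refine Finset.prod_le_prod (fun x _ => ?_) fun x _ =>
          sum_binomW_mul_exp_le hK (h0 x) (h1 x) (a x) c (hc x) hc1
        exact Finset.sum_nonneg fun k _ =>
          mul_nonneg (binomW_pos (h0 x) (h1 x) k).le (Real.exp_pos _).le
    _ = _ := by
        rw [← Real.exp_sum, Finset.sum_const, nsmul_eq_mul]
        simp

/-- A continuous function on `ℝ × ℝ^d` that is `ℤ^d`-periodic in space is bounded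
on compact time intervals. -/
lemma exists_bound_of_periodic {d : ℕ} (T : ℝ) (f : ℝ × (Fin d → ℝ) → ℝ) (hf : Continuous f)
    (hper : ∀ (s : ℝ) (u : Fin d → ℝ) (z : Fin d → ℤ), f (s, fun j => u j + z j) = f (s, u)) :
    ∃ M, 0 ≤ M ∧ ∀ s ∈ Set.Icc (0 : ℝ) T, ∀ u, |f (s, u)| ≤ M := by
  obtain ⟨M, hM⟩ := ((isCompact_Icc (a := (0 : ℝ)) (b := T)).prod
    (isCompact_Icc (a := (0 : Fin d → ℝ)) (b := 1))).exists_bound_of_continuousOn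
      hf.continuousOn
  refine ⟨max M 0, le_max_right _ _, fun s hs u => le_max_of_le_left ?_⟩
  have h1 := hper s u fun j => -⌊u j⌋
  rw [← h1]
  refine hM _ ⟨hs, ?_⟩
  simp only [Set.mem_Icc, Pi.le_def]
  constructor <;> intro j
  · simpa using Int.floor_le (u j)
  · have := Int.lt_floor_add_one (u j)
    simp only [Int.cast_neg, Pi.one_apply]
    linarith

lemma abs_sub_sub_mul_le {g g' g'' : ℝ → ℝ} {M : ℝ} (hg : ∀ h, HasDerivAt g (g' h) h)
    (hg' : ∀ h, HasDerivAt g' (g'' h) h) (hM : ∀ h, |g'' h| ≤ M) (h : ℝ) :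
    |g h - g 0 - g' 0 * h| ≤ M * h ^ 2 := by
  have h1 : ∀ x, |g' x - g' 0| ≤ M * |x| := by
    intro x
    have := Convex.norm_image_sub_le_of_norm_hasDerivWithin_le (f := g') (f' := g'')
      (s := Set.univ) (x := 0) (y := x) (C := M) (fun y _ => (hg' y).hasDerivWithinAt)
      (fun y _ => hM y) convex_univ (Set.mem_univ _) (Set.mem_univ _)
    simpa using this
  have hM0 : 0 ≤ M := (abs_nonneg _).trans (hM 0)
  have h2 := Convex.norm_image_sub_le_of_norm_hasDerivWithin_le
    (f := fun x => g x - g' 0 * x) (f' := fun x => g' x - g' 0)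
    (s := Set.uIcc 0 h) (x := 0) (y := h) (C := M * |h|)
    (fun y _ => ((hg y).sub (by simpa using (hasDerivAt_id y).const_mul (g' 0))).hasDerivWithinAt)
    (fun y hy => (h1 y).trans (mul_le_mul_of_nonneg_left
      (by simpa using Set.abs_sub_left_of_mem_uIcc hy) hM0))
    (convex_uIcc _ _) Set.left_mem_uIcc Set.right_mem_uIcc
  simp only [Real.norm_eq_abs, mul_zero, sub_zero, mul_assoc, abs_mul_abs_self] at h2
  rw [show g h - g 0 - g' 0 * h = g h - g' 0 * h - g 0 by ring, pow_two]
  exact h2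

lemma finCycAdd_finCycSub {N : ℕ} (a : Fin N) : finCycAdd (finCycSub a) = a := by
  have ha := a.isLt
  ext
  simp only [finCycAdd, finCycSub, Nat.mod_add_mod]
  rw [show a.val + (N - 1) + 1 = a.val + N by omega, Nat.add_mod_right, Nat.mod_eq_of_lt ha]

lemma finCycSub_finCycAdd {N : ℕ} (a : Fin N) : finCycSub (finCycAdd a) = a := by
  have ha := a.isLt
  ext
  simp only [finCycAdd, finCycSub, Nat.mod_add_mod]
  rw [show a.val + 1 + (N - 1) = a.val + N by omega, Nat.add_mod_right, Nat.mod_eq_of_lt ha]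

lemma siteMove_true_false {N d : ℕ} (x : Site N d) (i : Fin d) :
    siteMove (siteMove x i false) i true = x := by
  simp [siteMove, finCycAdd_finCycSub]

lemma siteMove_false_true {N d : ℕ} (x : Site N d) (i : Fin d) :
    siteMove (siteMove x i true) i false = x := by
  simp [siteMove, finCycSub_finCycAdd]

/-- Summation by parts on the discrete torus. -/
lemma sum_mul_siteMove_sub {N d : ℕ} (i : Fin d) (b w : Site N d → ℝ) :
    ∑ x, b x * (w (siteMove x i true) - w x) = ∑ x, (b (siteMove x i false) - b x) * w x := by
  simp only [mul_sub, sub_mul, Finset.sum_sub_distrib]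
  congr 1
  refine Fintype.sum_equiv
    ⟨fun x => siteMove x i true, fun x => siteMove x i false,
      fun x => siteMove_false_true x i, fun x => siteMove_true_false x i⟩ _ _ fun x => ?_
  simp [siteMove_false_true]

lemma siteCoord_siteMove {N d : ℕ} (hN : 1 ≤ N) (x : Site N d) (i : Fin d) (b : Bool) :
    ∃ z : Fin d → ℤ, siteCoord (siteMove x i b)
      = fun j => (siteCoord x + ((if b then 1 else -1) / (N : ℝ)) • Pi.single i (1 : ℝ)
          : Fin d → ℝ) j + (z j : ℝ) := by
  have hN' : (N : ℝ) ≠ 0 := by positivity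
  have hmod : ∀ n : ℕ, ((n % N : ℕ) : ℝ) / N = (n : ℝ) / N - ((n / N : ℕ) : ℝ) := by
    intro n
    have h : ((N * (n / N) + n % N : ℕ) : ℝ) = n := by rw [Nat.div_add_mod]
    push_cast at h
    field_simp
    linarith
  cases b
  · refine ⟨Pi.single i (1 - (((x i).val + (N - 1)) / N : ℕ)), ?_⟩
    funext j
    by_cases hj : j = i
    · subst hj
      simp only [siteCoord, siteMove, finCycSub, Function.update_self, Pi.add_apply,
        Pi.smul_apply, Pi.single_eq_same, Bool.false_eq_true, if_false, hmod]
      generalize ((x j).val + (N - 1)) / N = k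
      push_cast [Nat.cast_sub hN]
      simp only [smul_eq_mul, mul_one]
      field_simp
      ring
    · simp [siteCoord, siteMove, hj]
  · refine ⟨Pi.single i (-(((x i).val + 1) / N : ℕ)), ?_⟩
    funext j
    by_cases hj : j = i
    · subst hj
      simp only [siteCoord, siteMove, finCycAdd, Function.update_self, Pi.add_apply,
        Pi.smul_apply, Pi.single_eq_same, if_true, hmod]
      generalize ((x j).val + 1) / N = k
      push_cast
      simp only [smul_eq_mul, mul_one]
      field_simp
      ring
    · simp [siteCoord, siteMove, hj]

/-- Expansion of the discrete current difference in one direction. -/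
lemma abs_current_sub_le {K p q R ε δ M r r₁ r₂ g : ℝ} (hp : 0 ≤ p) (hq : 0 ≤ q) (hε : 0 ≤ ε)
    (hK : 0 ≤ K) (h0 : 0 ≤ R + ε * r) (h1 : R + ε * r ≤ K)
    (hr₁ : |r₁ - r - g * δ| ≤ M * δ ^ 2) (hr₂ : |r₂ - r - g * (-δ)| ≤ M * (-δ) ^ 2) :
    |K * (p * (R + ε * r₂) * (K - (R + ε * r)) - q * (R + ε * r) * (K - (R + ε * r₂)))
      - K * (p * (R + ε * r) * (K - (R + ε * r₁)) - q * (R + ε * r₁) * (K - (R + ε * r)))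
      + K * ε * δ * ((p - q) * (K - 2 * (R + ε * r)) * g)|
      ≤ K ^ 2 * M * ε * δ ^ 2 * (p + q) := by
  rw [neg_sq] at hr₂
  set b := R + ε * r with hb
  set e₁ := r₁ - r - g * δ with he₁
  set e₂ := r₂ - r - g * (-δ) with he₂
  have h2 : K * (p * (R + ε * r₂) * (K - b) - q * b * (K - (R + ε * r₂)))
      - K * (p * b * (K - (R + ε * r₁)) - q * (R + ε * r₁) * (K - b))
      + K * ε * δ * ((p - q) * (K - 2 * b) * g)
      = K * ε * (e₂ * (p * (K - b) + q * b) + e₁ * (q * (K - b) + p * b)) := by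
    rw [he₁, he₂, hb]
    ring
  have hKb : 0 ≤ K - b := by linarith
  rw [h2, abs_mul, abs_of_nonneg (by positivity)]
  have h3 : |e₂ * (p * (K - b) + q * b) + e₁ * (q * (K - b) + p * b)|
      ≤ M * δ ^ 2 * (p * (K - b) + q * b) + M * δ ^ 2 * (q * (K - b) + p * b) := by
    refine (abs_add_le _ _).trans (add_le_add ?_ ?_)
    · rw [abs_mul, abs_of_nonneg (by positivity : 0 ≤ p * (K - b) + q * b)]
      gcongr
    · rw [abs_mul, abs_of_nonneg (by positivity : 0 ≤ q * (K - b) + p * b)]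
      gcongr
  calc _ ≤ K * ε * (M * δ ^ 2 * (p * (K - b) + q * b) + M * δ ^ 2 * (q * (K - b) + p * b)) := by
        gcongr
    _ = _ := by ring

lemma exists_spatial_bounds {d : ℕ} (T : ℝ) (F : ℝ × (Fin d → ℝ) → ℝ)
    (hF : ContDiff ℝ (⊤ : ℕ∞) F)
    (hper : ∀ (s : ℝ) (u : Fin d → ℝ) (z : Fin d → ℤ), F (s, fun j => u j + z j) = F (s, u)) :
    ∃ B M : ℝ, 0 ≤ B ∧ 0 ≤ M ∧ ∀ s ∈ Set.Icc (0 : ℝ) T, ∀ u : Fin d → ℝ, |F (s, u)| ≤ B ∧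
      ∀ (i : Fin d) (h : ℝ), |F (s, u + h • Pi.single i (1 : ℝ)) - F (s, u)
        - fderiv ℝ F (s, u) (0, Pi.single i 1) * h| ≤ M * h ^ 2 := by
  have hdir : ∀ f : ℝ × (Fin d → ℝ) → ℝ, ContDiff ℝ (⊤ : ℕ∞) f →
      ∀ v, ContDiff ℝ (⊤ : ℕ∞) fun q => fderiv ℝ f q v := fun f hf v =>
    (hf.fderiv_right (by simp)).clm_apply contDiff_const
  have hdirper : ∀ f : ℝ × (Fin d → ℝ) → ℝ,
      (∀ (s : ℝ) (u : Fin d → ℝ) (z : Fin d → ℤ), f (s, fun j => u j + z j) = f (s, u)) →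
      ∀ v, ∀ (s : ℝ) (u : Fin d → ℝ) (z : Fin d → ℤ),
        fderiv ℝ f (s, fun j => u j + z j) v = fderiv ℝ f (s, u) v := by
    intro f hf v s u z
    have h1 : (fun q : ℝ × (Fin d → ℝ) => f (q + ((0 : ℝ), fun j => (z j : ℝ)))) = f := by
      funext q
      have := hf q.1 q.2 z
      simpa [Prod.add_def, Pi.add_def] using this
    have h2 := fderiv_comp_add_right (𝕜 := ℝ) (f := f) (x := (s, u))
      ((0 : ℝ), fun j => (z j : ℝ))
    rw [h1] at h2
    rw [h2]
    simp [Prod.mk_add_mk, Pi.add_def]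
  have hline : ∀ f : ℝ × (Fin d → ℝ) → ℝ, ContDiff ℝ (⊤ : ℕ∞) f →
      ∀ (i : Fin d) (s : ℝ) (u : Fin d → ℝ) (h : ℝ),
        HasDerivAt (fun h : ℝ => f (s, u + h • Pi.single i (1 : ℝ)))
          (fderiv ℝ f (s, u + h • Pi.single i (1 : ℝ)) (0, Pi.single i 1)) h := by
    intro f hf i s u h
    have h1 : HasDerivAt (fun h : ℝ => (s, u + h • (Pi.single i (1 : ℝ) : Fin d → ℝ)))
        (0, Pi.single i 1) h := by
      refine (hasDerivAt_const h s).prodMk ?_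
      simpa using ((hasDerivAt_id h).smul_const (Pi.single i (1 : ℝ) : Fin d → ℝ)).const_add u
    exact ((hf.differentiable (by simp)) _).hasFDerivAt.comp_hasDerivAt h h1
  obtain ⟨B, hB0, hB⟩ := exists_bound_of_periodic T F hF.continuous hper
  choose M hM0 hM using fun i : Fin d => exists_bound_of_periodic T
    (fun q => fderiv ℝ (fun q => fderiv ℝ F q (0, Pi.single i 1)) q (0, Pi.single i 1))
    (hdir _ (hdir F hF _) _).continuous (hdirper _ (hdirper F hper _) _)
  refine ⟨B, ∑ i, M i, hB0, Finset.sum_nonneg fun i _ => hM0 i, fun s hs u =>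
    ⟨hB s hs u, fun i h => ?_⟩⟩
  have h1 := abs_sub_sub_mul_le (hline F hF i s u) (hline _ (hdir F hF _) i s u)
    (fun h => hM i s hs _) h
  simp only [zero_smul, add_zero] at h1
  refine h1.trans (mul_le_mul_of_nonneg_right ?_ (sq_nonneg h))
  exact Finset.single_le_sum (f := M) (fun i _ => hM0 i) (Finset.mem_univ i)

lemma hasDerivAt_profileGE {d : ℕ} (K : ℕ) (ϱs α κ : ℝ) (m : Fin d → ℝ)
    (ρ : ℝ → (Fin d → ℝ) → ℝ) (hρ : Differentiable ℝ fun q : ℝ × (Fin d → ℝ) => ρ q.1 q.2)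
    (N : ℕ) (t : ℝ) (u : Fin d → ℝ) :
    HasDerivAt (fun s => profileGE d K ϱs α κ m ρ N s u)
      ((N : ℝ) ^ (-α) * ((N : ℝ) ^ (κ - α) * deriv (fun s' => ρ s'
          (fun j => u j - (N : ℝ) ^ κ * ((K : ℝ) - 2 * ϱs) * t * m j)) ((N : ℝ) ^ (κ - α) * t)
        - (N : ℝ) ^ κ * ((K : ℝ) - 2 * ϱs) * ∑ i, m i *
          fderiv ℝ (fun q : ℝ × (Fin d → ℝ) => ρ q.1 q.2) ((N : ℝ) ^ (κ - α) * t,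
            fun j => u j - (N : ℝ) ^ κ * ((K : ℝ) - 2 * ϱs) * t * m j) (0, Pi.single i 1))) t := by
  set F : ℝ × (Fin d → ℝ) → ℝ := fun q => ρ q.1 q.2 with hFdef
  set a := (N : ℝ) ^ (κ - α)
  set c := (N : ℝ) ^ κ * ((K : ℝ) - 2 * ϱs)
  have hpath : HasDerivAt (fun s : ℝ => (a * s, fun j => u j - c * s * m j))
      (a, fun j => -(c * m j)) t := by
    refine HasDerivAt.prodMk (by simpa using (hasDerivAt_id t).const_mul a) ?_
    rw [hasDerivAt_pi]
    intro j
    simpa using ((((hasDerivAt_id t).const_mul c).mul_const (m j)).const_sub (u j))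
  have htime : deriv (fun s' => ρ s' fun j => u j - c * t * m j) (a * t)
      = fderiv ℝ F (a * t, fun j => u j - c * t * m j) (1, 0) := by
    have h1 : HasDerivAt (fun s' : ℝ => (s', fun j => u j - c * t * m j))
        ((1 : ℝ), (0 : Fin d → ℝ)) (a * t) :=
      (hasDerivAt_id _).prodMk (hasDerivAt_const _ _)
    exact ((hρ (a * t, fun j => u j - c * t * m j)).hasFDerivAt.comp_hasDerivAt
      (a * t) h1).deriv
  have hdec : ((a, fun j => -(c * m j)) : ℝ × (Fin d → ℝ))
      = a • ((1 : ℝ), (0 : Fin d → ℝ))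
        + ∑ i, (-(c * m i)) • ((0 : ℝ), (Pi.single i (1 : ℝ) : Fin d → ℝ)) := by
    refine Prod.ext ?_ ?_
    · simp [Prod.fst_sum]
    · funext j
      simp [Prod.snd_sum, Finset.sum_apply, Pi.single_apply]
  have h2 := ((hρ (a * t, fun j => u j - c * t * m j)).hasFDerivAt.comp_hasDerivAt t hpath)
  have h3 := (h2.const_mul ((N : ℝ) ^ (-α))).const_add ϱs
  refine h3.congr_deriv ?_
  rw [htime, hdec, map_add, map_smul, map_sum]
  simp only [map_smul, smul_eq_mul]
  congr 1
  rw [sub_eq_add_neg, Finset.mul_sum, ← Finset.sum_neg_distrib]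
  congr 1
  exact Finset.sum_congr rfl fun i _ => by ring

/-- The Burgers equation cancels the leading orders of the drift. -/
lemma abs_drift_le {d K N : ℕ} (hN : 1 ≤ N)
    (p : Fin d → Bool → ℝ) (hp : ∀ i b, 0 ≤ p i b) (ϱs α κ t M : ℝ)
    (ρ : ℝ → (Fin d → ℝ) → ℝ)
    (hρ : Differentiable ℝ fun q : ℝ × (Fin d → ℝ) => ρ q.1 q.2)
    (hper : ∀ (s : ℝ) (u : Fin d → ℝ) (z : Fin d → ℤ), ρ s (fun j => u j + z j) = ρ s u)
    (hpde : ∀ u : Fin d → ℝ,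
      deriv (fun s' => ρ s' u) ((N : ℝ) ^ (κ - α) * t)
        = ∑ i, (p i true - p i false) * deriv (fun h =>
          ρ ((N : ℝ) ^ (κ - α) * t) (Function.update u i h) ^ 2) (u i))
    (htaylor : ∀ (u : Fin d → ℝ) (i : Fin d) (h : ℝ),
      |ρ ((N : ℝ) ^ (κ - α) * t) (u + h • Pi.single i (1 : ℝ)) - ρ ((N : ℝ) ^ (κ - α) * t) u
        - fderiv ℝ (fun q : ℝ × (Fin d → ℝ) => ρ q.1 q.2) ((N : ℝ) ^ (κ - α) * t, u)
          (0, Pi.single i 1) * h| ≤ M * h ^ 2)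
    (ϱ : ℝ → Site N d → ℝ)
    (hϱ : ∀ s x, ϱ s x
      = profileGE d K ϱs α κ (fun i => p i true - p i false) ρ N s (siteCoord x))
    (x : Site N d) (h0 : 0 ≤ ϱ t x) (h1 : ϱ t x ≤ K) :
    |(N : ℝ) ^ ((1 : ℝ) + κ) * ∑ i,
        ((K : ℝ) * (p i true * ϱ t (siteMove x i false) * ((K : ℝ) - ϱ t x)
            - p i false * ϱ t x * ((K : ℝ) - ϱ t (siteMove x i false)))
          - (K : ℝ) * (p i true * ϱ t x * ((K : ℝ) - ϱ t (siteMove x i true))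
            - p i false * ϱ t (siteMove x i true) * ((K : ℝ) - ϱ t x)))
      - (K : ℝ) * deriv (fun s => ϱ s x) t|
      ≤ (K : ℝ) ^ 2 * M * (∑ i, (p i true + p i false)) * (N : ℝ) ^ (κ - α - 1) := by
  have hN0 : (0 : ℝ) < N := by positivity
  have hderiv := (hasDerivAt_profileGE K ϱs α κ (fun i => p i true - p i false) ρ hρ N t
    (siteCoord x)).deriv
  simp only [← hϱ] at hderiv
  have hval : ∀ y, ϱ t y = ϱs + (N : ℝ) ^ (-α) * ρ ((N : ℝ) ^ (κ - α) * t)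
    (fun j => siteCoord y j - (N : ℝ) ^ κ * ((K : ℝ) - 2 * ϱs) * t
      * (p j true - p j false)) := fun y => hϱ t y
  set v : Fin d → ℝ := fun j => siteCoord x j - (N : ℝ) ^ κ * ((K : ℝ) - 2 * ϱs) * t
      * (p j true - p j false) with hv
  set s := (N : ℝ) ^ (κ - α) * t
  set F : ℝ × (Fin d → ℝ) → ℝ := fun q => ρ q.1 q.2 with hF
  set ε := (N : ℝ) ^ (-α) with hε
  set A := (N : ℝ) ^ κ with hA
  set r := ρ s v
  set g : Fin d → ℝ := fun i => fderiv ℝ F (s, v) (0, Pi.single i 1) with hg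
  have hε0 : 0 < ε := Real.rpow_pos_of_pos hN0 _
  have hA0 : 0 < A := Real.rpow_pos_of_pos hN0 _
  have hxval : ϱ t x = ϱs + ε * r := hval x
  have hnb : ∀ i b, ϱ t (siteMove x i b)
      = ϱs + ε * ρ s (v + ((if b then 1 else -1) / (N : ℝ)) • Pi.single i (1 : ℝ)) := by
    intro i b
    obtain ⟨z, hz⟩ := siteCoord_siteMove hN x i b
    have hshift := hper s (v + ((if b then 1 else -1) / (N : ℝ)) • Pi.single i (1 : ℝ)) z
    rw [hval, hz, ← hshift]
    congr 3
    funext j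
    simp only [hv, Pi.add_apply]
    ring
  have hsq : ∀ i, deriv (fun h => ρ s (Function.update v i h) ^ 2) (v i) = 2 * r * g i := by
    intro i
    have h2 : HasDerivAt (fun h : ℝ => (s, Function.update v i h))
        ((0 : ℝ), (Pi.single i (1 : ℝ) : Fin d → ℝ)) (v i) :=
      (hasDerivAt_const _ _).prodMk (hasDerivAt_update v i (v i))
    have h3 := (hρ (s, Function.update v i (v i))).hasFDerivAt.comp_hasDerivAt (v i) h2
    rw [Function.update_eq_self] at h3
    have h4 := (h3.pow 2).deriv
    simp only [Function.comp_def, Function.update_eq_self] at h4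
    refine Eq.trans ?_ (h4.trans ?_)
    · rfl
    · simp [hg, hF, r]
  have hAε : (N : ℝ) ^ (κ - α) = A * ε := by
    rw [hA, hε, ← Real.rpow_add hN0, sub_eq_add_neg]
  have hNA : (N : ℝ) ^ ((1 : ℝ) + κ) = N * A := by
    rw [Real.rpow_add hN0, Real.rpow_one]
  have hpow : (N : ℝ) ^ (κ - α - 1) = A * ε / N := by
    rw [Real.rpow_sub hN0, Real.rpow_one, hAε]
  rw [hderiv, hpde v, hAε, hNA, hpow]
  simp only [hsq]
  set X : Fin d → ℝ := fun i =>
    (K : ℝ) * (p i true * ϱ t (siteMove x i false) * ((K : ℝ) - ϱ t x)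
            - p i false * ϱ t x * ((K : ℝ) - ϱ t (siteMove x i false)))
          - (K : ℝ) * (p i true * ϱ t x * ((K : ℝ) - ϱ t (siteMove x i true))
            - p i false * ϱ t (siteMove x i true) * ((K : ℝ) - ϱ t x)) with hX
  have hXb : ∀ i, |X i + K * ε * (1 / N) * ((p i true - p i false)
      * (K - 2 * (ϱs + ε * r)) * g i)| ≤ (K : ℝ) ^ 2 * M * ε * (1 / N) ^ 2
        * (p i true + p i false) := by
    intro i
    simp only [hX, hnb, hxval]
    have ht := htaylor v i (1 / N)
    have hf := htaylor v i (-(1 / N))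
    rw [← neg_div] at hf
    refine abs_current_sub_le (hp i true) (hp i false) hε0.le (Nat.cast_nonneg K)
      (hxval ▸ h0) (hxval ▸ h1) ?_ ?_
    · simpa using ht
    · simpa [neg_div] using hf
  have hid : (N : ℝ) * A * ∑ i, X i - K * (ε * (A * ε * ∑ i, (p i true - p i false)
        * (2 * r * g i) - A * (K - 2 * ϱs) * ∑ i, (p i true - p i false) * g i))
      = N * A * ∑ i, (X i + K * ε * (1 / N) * ((p i true - p i false)
      * (K - 2 * (ϱs + ε * r)) * g i)) := by
    rw [Finset.sum_add_distrib, mul_add, sub_eq_add_neg]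
    congr 1
    simp only [Finset.mul_sum, ← Finset.sum_sub_distrib, ← Finset.sum_neg_distrib]
    refine Finset.sum_congr rfl fun i _ => ?_
    field_simp
    ring
  change |(N : ℝ) * A * ∑ i, X i - K * (ε * (A * ε * ∑ i, (p i true - p i false)
        * (2 * r * g i) - A * (K - 2 * ϱs) * ∑ i, (p i true - p i false) * g i))| ≤ _
  rw [hid, abs_mul, abs_of_pos (mul_pos hN0 hA0)]
  calc _ ≤ (N : ℝ) * A * ∑ i, (K : ℝ) ^ 2 * M * ε * (1 / N) ^ 2 * (p i true + p i false) := by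
        refine mul_le_mul_of_nonneg_left ?_ (mul_pos hN0 hA0).le
        exact (Finset.abs_sum_le_sum_abs _ _).trans (Finset.sum_le_sum fun i _ => hXb i)
    _ = _ := by
        rw [← Finset.mul_sum]
        field_simp

/-- Estimate for the error term `E_{N,t}` in the relative entropy computation for the
generalized exclusion process: with `ω_x = (η_x − ϱ_x)/(ϱ_x(K−ϱ_x))` and
`b_N(x,x+e_i) = K[p_i ϱ_x(K−ϱ_{x+e_i}) − p_{i+d} ϱ_{x+e_i}(K−ϱ_x)]`, there is a
constant `C` (independent of `N` and `t ∈ [0,T]`) such that for all large `N`,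
`E_{N,t} ≤ H_N(t) + C N^{d+2κ−2α−2}`. -/
theorem statement2 (d K : ℕ) (hd : 1 ≤ d) (hK : 1 ≤ K)
    (p : Fin d → Bool → ℝ) (hp : ∀ i b, 0 ≤ p i b)
    (hpd : ∀ i, 0 < p i true + p i false)
    (hm : (fun i => p i true - p i false) ≠ (0 : Fin d → ℝ))
    (ϱs : ℝ) (hϱs : ϱs ∈ Set.Ioo (0 : ℝ) (K : ℝ))
    (α κ T : ℝ) (hα : 0 < α) (hκ : 0 < κ) (hκα : κ ≤ α) (hT : 0 < T)
    (ρ : ℝ → (Fin d → ℝ) → ℝ)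
    (hρsmooth : ContDiff ℝ (⊤ : ℕ∞) (fun q : ℝ × (Fin d → ℝ) => ρ q.1 q.2))
    (hρper : ∀ (s : ℝ) (u : Fin d → ℝ) (z : Fin d → ℤ),
      ρ s (fun j => u j + z j) = ρ s u)
    (hρpde : ∀ s ∈ Set.Icc (0 : ℝ) T, ∀ u : Fin d → ℝ,
      deriv (fun s' => ρ s' u) s
        = ∑ i, (p i true - p i false)
            * deriv (fun h => ρ s (Function.update u i h) ^ 2) (u i))
    (μ : (N : ℕ) → ℝ → GCfg N d K → ℝ)
    (hμprob : ∀ (N : ℕ) (t : ℝ), 0 ≤ t → (∀ η, 0 ≤ μ N t η) ∧ ∑ η, μ N t η = 1)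
    (hkolm : ∀ (N : ℕ), 1 ≤ N → ∀ (f : GCfg N d K → ℝ) (t : ℝ), 0 ≤ t →
      HasDerivAt (fun s => ∑ η, f η * μ N s η)
        ((N : ℝ) ^ ((1 : ℝ) + κ) * ∑ η, genL p f η * μ N t η) t) :
    -- local density `ϱ_x`, centered variable `ω_x`, coefficient `b_N`, entropy `H_N`
    let ϱ : (N : ℕ) → ℝ → Site N d → ℝ := fun N t x =>
      profileGE d K ϱs α κ (fun i => p i true - p i false) ρ N t (siteCoord x)
    let ω : (N : ℕ) → ℝ → Site N d → GCfg N d K → ℝ := fun N t x η =>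
      (((η x).val : ℝ) - ϱ N t x) / (ϱ N t x * ((K : ℝ) - ϱ N t x))
    let bN : (N : ℕ) → ℝ → Fin d → Site N d → ℝ := fun N t i x =>
      (K : ℝ) * (p i true * ϱ N t x * ((K : ℝ) - ϱ N t (siteMove x i true))
        - p i false * ϱ N t (siteMove x i true) * ((K : ℝ) - ϱ N t x))
    let HN : ℕ → ℝ → ℝ := fun N t => relEnt (μ N t) (prodBinom (ϱ N t))
    let E : ℕ → ℝ → ℝ := fun N t =>
      ∑ η : GCfg N d K,
        ((N : ℝ) ^ ((1 : ℝ) + κ)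
            * ∑ i : Fin d, ∑ x : Site N d,
                bN N t i x * (ω N t (siteMove x i true) η - ω N t x η)
          - (K : ℝ) * ∑ x : Site N d, ω N t x η * deriv (fun s => ϱ N s x) t)
          * μ N t η
    ∃ C : ℝ, ∃ N₀ : ℕ, ∀ N : ℕ, N₀ ≤ N → ∀ t ∈ Set.Icc (0 : ℝ) T,
      E N t ≤ HN N t + C * (N : ℝ) ^ ((d : ℝ) + 2 * κ - 2 * α - 2) := by
  intro ϱ ω bN HN E
  set F : ℝ × (Fin d → ℝ) → ℝ := fun q => ρ q.1 q.2 with hF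
  obtain ⟨B, M, hB0, hM0, hBM⟩ := exists_spatial_bounds T F hρsmooth hρper
  obtain ⟨hϱs0, hϱs1⟩ := hϱs
  obtain ⟨c₀, hc₀, hc₀1, hc₀2⟩ : ∃ c₀ : ℝ, 0 < c₀ ∧ 2 * c₀ ≤ ϱs ∧ 2 * c₀ ≤ K - ϱs := by
    refine ⟨min ϱs (K - ϱs) / 2, half_pos (lt_min hϱs0 (sub_pos.2 hϱs1)), ?_, ?_⟩
    · linarith [min_le_left ϱs (K - ϱs)]
    · linarith [min_le_right ϱs (K - ϱs)]
  set C₁ : ℝ := (K : ℝ) ^ 2 * M * ∑ i, (p i true + p i false) with hC₁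
  have hC₁0 : 0 ≤ C₁ := mul_nonneg (by positivity) (Finset.sum_nonneg fun i _ => (hpd i).le)
  set C₂ : ℝ := C₁ * K / c₀ ^ 2 with hC₂
  have hC₂0 : 0 ≤ C₂ := by positivity
  have hsmall : ∀ᶠ N : ℕ in atTop, B * (N : ℝ) ^ (-α) ≤ c₀ := by
    have h := ((tendsto_rpow_neg_atTop hα).comp tendsto_natCast_atTop_atTop).const_mul B
    rw [mul_zero] at h
    exact h.eventually_le_const hc₀
  have hlarge : ∀ᶠ N : ℕ in atTop, C₂ ≤ (N : ℝ) :=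
    tendsto_natCast_atTop_atTop.eventually_ge_atTop C₂
  obtain ⟨N₀, hN₀⟩ := eventually_atTop.1 (hsmall.and (hlarge.and (eventually_ge_atTop 1)))
  refine ⟨C₂ ^ 2, N₀, fun N hN t ht => ?_⟩
  obtain ⟨hNs, hNl, hN1⟩ := hN₀ N hN
  have hNpos : (0 : ℝ) < N := by positivity
  have hN1' : (1 : ℝ) ≤ N := by exact_mod_cast hN1
  have hs : (N : ℝ) ^ (κ - α) * t ∈ Set.Icc (0 : ℝ) T := by
    have h1 : (N : ℝ) ^ (κ - α) ≤ 1 := Real.rpow_le_one_of_one_le_of_nonpos hN1' (by linarith)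
    have h2 : 0 < (N : ℝ) ^ (κ - α) := Real.rpow_pos_of_pos hNpos _
    exact ⟨mul_nonneg h2.le ht.1, (mul_le_of_le_one_left ht.1 h1).trans ht.2⟩
  have hclose : ∀ x, |ϱ N t x - ϱs| ≤ c₀ := by
    intro x
    have h1 := (hBM _ hs (fun j => siteCoord x j
      - (N : ℝ) ^ κ * ((K : ℝ) - 2 * ϱs) * t * (p j true - p j false))).1
    have h2 : 0 < (N : ℝ) ^ (-α) := Real.rpow_pos_of_pos hNpos _
    simp only [ϱ, profileGE, add_sub_cancel_left, abs_mul, abs_of_pos h2]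
    refine le_trans ?_ hNs
    rw [mul_comm]
    exact mul_le_mul_of_nonneg_right h1 h2.le
  have hlow : ∀ x, c₀ ≤ ϱ N t x := fun x => by
    linarith [(abs_le.1 (hclose x)).1]
  have hupp : ∀ x, c₀ ≤ K - ϱ N t x := fun x => by
    linarith [(abs_le.1 (hclose x)).2]
  have hϱ0 : ∀ x, 0 < ϱ N t x := fun x => hc₀.trans_le (hlow x)
  have hϱ1 : ∀ x, ϱ N t x < K := fun x => by linarith [hupp x]
  set V : Site N d → ℝ := fun x => (N : ℝ) ^ ((1 : ℝ) + κ)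
      * ∑ i, (bN N t i (siteMove x i false) - bN N t i x)
    - (K : ℝ) * deriv (fun s => ϱ N s x) t with hV
  have hVb : ∀ x, |V x| ≤ C₁ * (N : ℝ) ^ (κ - α - 1) := by
    intro x
    simp only [hV, bN, siteMove_true_false]
    exact abs_drift_le hN1 p hp ϱs α κ t M ρ (hρsmooth.differentiable (by simp)) hρper
      (hρpde _ hs) (fun u => (hBM _ hs u).2) (ϱ N) (fun _ _ => rfl) x (hϱ0 x).le (hϱ1 x).le
  set a : Site N d → ℝ := fun x => V x / (ϱ N t x * ((K : ℝ) - ϱ N t x)) with ha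
  set c : ℝ := C₂ * (N : ℝ) ^ (κ - α - 1) with hc
  have hac : ∀ x, |a x| * K ≤ c := by
    intro x
    have h1 : c₀ ^ 2 ≤ ϱ N t x * ((K : ℝ) - ϱ N t x) := by
      rw [pow_two]
      exact mul_le_mul (hlow x) (hupp x) hc₀.le (hϱ0 x).le
    have h2 : |a x| ≤ C₁ * (N : ℝ) ^ (κ - α - 1) / c₀ ^ 2 := by
      rw [ha, abs_div, abs_of_pos ((pow_pos hc₀ 2).trans_le h1)]
      exact div_le_div₀ (by positivity) (hVb x) (by positivity) h1
    calc _ ≤ C₁ * (N : ℝ) ^ (κ - α - 1) / c₀ ^ 2 * K :=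
          mul_le_mul_of_nonneg_right h2 (Nat.cast_nonneg K)
      _ = c := by
          rw [hc, hC₂]
          ring
  have hc1 : c ≤ 1 := by
    have h1 : (N : ℝ) ^ (κ - α - 1) ≤ (N : ℝ) ^ (-1 : ℝ) :=
      Real.rpow_le_rpow_of_exponent_le hN1' (by linarith)
    rw [Real.rpow_neg_one] at h1
    calc c ≤ N * (N : ℝ)⁻¹ := mul_le_mul hNl h1 (by positivity) hNpos.le
      _ = 1 := mul_inv_cancel₀ hNpos.ne'
  have hE : E N t = ∑ η, (∑ x, a x * (((η x).val : ℝ) - ϱ N t x)) * μ N t η := by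
    refine Finset.sum_congr rfl fun η _ => ?_
    congr 1
    have hparts : ∀ i, ∑ x, bN N t i x * (ω N t (siteMove x i true) η - ω N t x η)
        = ∑ x, (bN N t i (siteMove x i false) - bN N t i x) * ω N t x η := fun i =>
      sum_mul_siteMove_sub i (bN N t i) fun x => ω N t x η
    rw [Finset.sum_congr rfl fun i _ => hparts i, Finset.sum_comm, Finset.mul_sum, Finset.mul_sum, ← Finset.sum_sub_distrib]
    refine Finset.sum_congr rfl fun x _ => ?_
    rw [← Finset.sum_mul]
    simp only [ha, hV, ω]
    ring
  have hpow : (N : ℝ) ^ d * c ^ 2 = C₂ ^ 2 * (N : ℝ) ^ ((d : ℝ) + 2 * κ - 2 * α - 2) := by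
    rw [hc, mul_pow, ← Real.rpow_natCast ((N : ℝ) ^ (κ - α - 1)), ← Real.rpow_mul hNpos.le,
      ← Real.rpow_natCast (N : ℝ), mul_left_comm, ← Real.rpow_add hNpos]
    congr 2
    push_cast
    ring
  obtain ⟨hμ0, hμ1⟩ := hμprob N t ht.1
  rw [hE, ← hpow]
  exact sum_mul_le_relEnt_add (μ N t) (prodBinom (ϱ N t)) _ _ hμ0 hμ1
    (fun η => Finset.prod_pos fun x _ => binomW_pos (hϱ0 x) (hϱ1 x) (η x))
    (sum_prodBinom_mul_exp_le hK (ϱ N t) hϱ0 hϱ1 a c hac hc1)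
end

section
/- Integration by parts formula: let ν be the product measure on Ω_N^d with marginal Binomial(K, ϱ_y/K) at each site y, where ϱ_y ∈ (0,K), and set ω_y(η) = (η_y − ϱ_y)/(ϱ_y(K − ϱ_y)) and s_{x,z}(η) = η_x(K − η_z)/(ϱ_x(K − ϱ_z)). Let x ≠ z be two sites and let h : Ω_N^d → ℝ be a function that does not depend on the values of η_x and η_z, and let f be a ν-density. Then Σ_η h(η)[ω_z(η) − ω_x(η)] f(η) ν(η) = (1/K) Σ_η h(η) s_{x,z}(η) [f(η^{x,z}) − f(η)] ν(η) − (ϱ_z − ϱ_x) Σ_η h(η) f(η) ω_z(η) ω_x(η) ν(η). -/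
open Real Filter

theorem binomW_succ {K k : ℕ} {r : ℝ} (hk : k < K) :
    binomW K r (k + 1) * (k + 1) * (K - r) = binomW K r k * (K - k) * r := by
  have hK : (K : ℝ) ≠ 0 := by
    have : K ≠ 0 := by omega
    exact_mod_cast this
  have hc : (K.choose (k + 1) : ℝ) * (k + 1) = K.choose k * (K - k) := by
    have := Nat.choose_succ_right_eq K k
    rw [← Nat.cast_sub hk.le]
    exact_mod_cast this
  have hp : K - k = (K - (k + 1)) + 1 := by omega
  have hr : (K : ℝ) - r = K * (1 - r / K) := by field_simp
  have hr' : r = K * (r / K) := by field_simp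
  unfold binomW
  rw [hp, pow_succ, pow_succ, hr]
  generalize r / (K : ℝ) = q at *
  linear_combination (K : ℝ) * q ^ k * q * (1 - q) ^ (K - (k + 1)) * (1 - q) * hc
    - K.choose k * q ^ k * (1 - q) ^ (K - (k + 1)) * (1 - q) * (K - k) * hr'

theorem cfgJump_left {N d K : ℕ} (η : GCfg N d K) (x z : Site N d) :
    (cfgJump η x z x).val = (η x).val - 1 := by
  simp [cfgJump]

theorem cfgJump_right {N d K : ℕ} (η : GCfg N d K) {x z : Site N d} (hxz : x ≠ z) :
    (cfgJump η x z z).val = min ((η z).val + 1) K := by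
  simp [cfgJump, hxz.symm]

theorem cfgJump_of_ne {N d K : ℕ} (η : GCfg N d K) {x z w : Site N d}
    (hx : w ≠ x) (hz : w ≠ z) : cfgJump η x z w = η w := by
  simp [cfgJump, hx, hz]

theorem cfgJump_cfgJump {N d K : ℕ} (η : GCfg N d K) {x z : Site N d} (hxz : x ≠ z)
    (hx : (η x).val ≠ 0) (hz : (η z).val ≠ K) :
    cfgJump (cfgJump η x z) z x = η := by
  have h1 := (η x).isLt
  have h2 := (η z).isLt
  funext w
  apply Fin.ext
  by_cases hwx : w = x
  · subst hwx
    rw [cfgJump_right _ hxz.symm, cfgJump_left]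
    omega
  by_cases hwz : w = z
  · subst hwz
    rw [cfgJump_left, cfgJump_right _ hxz]
    omega
  rw [cfgJump_of_ne _ hwz hwx, cfgJump_of_ne _ hwx hwz]

theorem prodBinom_eq_mul {N d K : ℕ} (ϱ : Site N d → ℝ) (η : GCfg N d K)
    {x z : Site N d} (hxz : x ≠ z) :
    prodBinom ϱ η = binomW K (ϱ x) (η x).val * (binomW K (ϱ z) (η z).val *
      ∏ w ∈ (Finset.univ.erase x).erase z, binomW K (ϱ w) (η w).val) := by
  unfold prodBinom
  rw [← Finset.mul_prod_erase _ _ (Finset.mem_univ x),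
    ← Finset.mul_prod_erase (Finset.univ.erase x) _
      (Finset.mem_erase.2 ⟨hxz.symm, Finset.mem_univ z⟩)]

/-- Reversibility of the jump `x → z` up to the ratio of the fugacities at `x` and `z`. -/
theorem prodBinom_cfgJump {N d K : ℕ} (ϱ : Site N d → ℝ)
    (hϱ : ∀ y, ϱ y ∈ Set.Ioo (0 : ℝ) (K : ℝ)) (η : GCfg N d K)
    {x z : Site N d} (hxz : x ≠ z) (hx : (η x).val ≠ 0) (hz : (η z).val ≠ K) :
    ((η x).val : ℝ) * ((K : ℝ) - ((η z).val : ℝ)) / (ϱ x * ((K : ℝ) - ϱ z)) * prodBinom ϱ η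
      = ((cfgJump η x z z).val : ℝ) * ((K : ℝ) - ((cfgJump η x z x).val : ℝ)) /
          (ϱ z * ((K : ℝ) - ϱ x)) * prodBinom ϱ (cfgJump η x z) := by
  rw [prodBinom_eq_mul ϱ η hxz, prodBinom_eq_mul ϱ (cfgJump η x z) hxz, cfgJump_left,
    cfgJump_right η hxz]
  have hrest : ∏ w ∈ (Finset.univ.erase x).erase z, binomW K (ϱ w) (cfgJump η x z w).val
      = ∏ w ∈ (Finset.univ.erase x).erase z, binomW K (ϱ w) (η w).val := by
    refine Finset.prod_congr rfl fun w hw => ?_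
    simp only [Finset.mem_erase] at hw
    rw [cfgJump_of_ne η hw.2.1 hw.1]
  rw [hrest]
  generalize ∏ w ∈ (Finset.univ.erase x).erase z, binomW K (ϱ w) (η w).val = c
  have hxK := (η x).isLt
  have hzK := (η z).isLt
  obtain ⟨m, hm⟩ := Nat.exists_eq_succ_of_ne_zero hx
  generalize (η z).val = n at *
  rw [hm] at hxK ⊢
  rw [min_eq_left (by omega), Nat.succ_sub_one, Nat.succ_eq_add_one]
  have hA := binomW_succ (K := K) (k := m) (r := ϱ x) (by omega)
  have hB := binomW_succ (K := K) (k := n) (r := ϱ z) (by omega)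
  obtain ⟨ha, ha'⟩ := hϱ x
  obtain ⟨hb, hb'⟩ := hϱ z
  generalize ϱ x = a at *
  generalize ϱ z = b at *
  have ha'' : (K : ℝ) - a ≠ 0 := by linarith
  have hb'' : (K : ℝ) - b ≠ 0 := by linarith
  push_cast
  field_simp
  linear_combination c * (K - n) * b * binomW K b n * hA
    - c * (K - m) * a * binomW K a m * hB

theorem sum_cfgJump_eq {N d K : ℕ} (ϱ : Site N d → ℝ)
    (hϱ : ∀ y, ϱ y ∈ Set.Ioo (0 : ℝ) (K : ℝ)) {x z : Site N d} (hxz : x ≠ z)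
    (h : GCfg N d K → ℝ)
    (hh : ∀ η η' : GCfg N d K, (∀ w, w ≠ x → w ≠ z → η w = η' w) → h η = h η')
    (f : GCfg N d K → ℝ) :
    ∑ η : GCfg N d K, h η * (((η x).val : ℝ) * ((K : ℝ) - ((η z).val : ℝ)) /
        (ϱ x * ((K : ℝ) - ϱ z))) * f (cfgJump η x z) * prodBinom ϱ η
      = ∑ η : GCfg N d K, h η * (((η z).val : ℝ) * ((K : ℝ) - ((η x).val : ℝ)) /
        (ϱ z * ((K : ℝ) - ϱ x))) * f η * prodBinom ϱ η := by
  have support (x z : Site N d) (η : GCfg N d K) {A B C D : ℝ}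
      (hne : A * (((η x).val : ℝ) * ((K : ℝ) - ((η z).val : ℝ)) / B) * C * D ≠ 0) :
      (η x).val ≠ 0 ∧ (η z).val ≠ K := by
    constructor <;> intro h0 <;> simp [h0] at hne
  have target_mem (x z : Site N d) (hxz : x ≠ z) (η : GCfg N d K)
      (hη : (η x).val ≠ 0 ∧ (η z).val ≠ K) :
      (cfgJump η x z z).val ≠ 0 ∧ (cfgJump η x z x).val ≠ K := by
    have h1 := (η x).isLt
    have h2 := (η z).isLt
    rw [cfgJump_left, cfgJump_right η hxz]
    omega
  rw [← Finset.sum_filter_of_ne (p := fun η : GCfg N d K => (η x).val ≠ 0 ∧ (η z).val ≠ K)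
      fun η _ hne => support x z η hne,
    ← Finset.sum_filter_of_ne (p := fun η : GCfg N d K => (η z).val ≠ 0 ∧ (η x).val ≠ K)
      fun η _ hne => support z x η hne]
  refine Finset.sum_nbij' (fun η => cfgJump η x z) (fun η => cfgJump η z x) ?_ ?_ ?_ ?_ ?_
  · simpa using fun η h1 h2 => target_mem x z hxz η ⟨h1, h2⟩
  · simpa using fun η h1 h2 => target_mem z x hxz.symm η ⟨h1, h2⟩
  · intro η hη
    obtain ⟨-, h1, h2⟩ := Finset.mem_filter.1 hη
    exact cfgJump_cfgJump η hxz h1 h2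
  · intro η hη
    obtain ⟨-, h1, h2⟩ := Finset.mem_filter.1 hη
    exact cfgJump_cfgJump η hxz.symm h1 h2
  · intro η hη
    obtain ⟨-, h1, h2⟩ := Finset.mem_filter.1 hη
    have hjump := prodBinom_cfgJump ϱ hϱ η hxz h1 h2
    have hinv : h (cfgJump η x z) = h η := hh _ _ fun w hx hz => cfgJump_of_ne η hx hz
    rw [hinv]
    linear_combination h η * f (cfgJump η x z) * hjump

/-- Integration by parts formula (Lemma `lem:integParts`) for the inhomogeneous
binomial product measure `ν`: if `h` does not depend on the values of `η_x` and `η_z`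
and `f` is a `ν`-density, then
`Σ_η h (ω_z − ω_x) f ν = (1/K) Σ_η h s_{x,z} (f(η^{x,z}) − f(η)) ν
  − (ϱ_z − ϱ_x) Σ_η h f ω_z ω_x ν`. -/
theorem statement4 (N d K : ℕ) (hK : 1 ≤ K)
    (ϱ : Site N d → ℝ) (hϱ : ∀ y, ϱ y ∈ Set.Ioo (0 : ℝ) (K : ℝ))
    (x z : Site N d) (hxz : x ≠ z)
    (h : GCfg N d K → ℝ)
    (hh : ∀ η η' : GCfg N d K, (∀ w, w ≠ x → w ≠ z → η w = η' w) → h η = h η')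
    (f : GCfg N d K → ℝ) (hf : ∀ η, 0 ≤ f η)
    (hf1 : ∑ η : GCfg N d K, f η * prodBinom ϱ η = 1) :
    let ω : Site N d → GCfg N d K → ℝ := fun y η =>
      (((η y).val : ℝ) - ϱ y) / (ϱ y * ((K : ℝ) - ϱ y))
    let s : GCfg N d K → ℝ := fun η =>
      ((η x).val : ℝ) * ((K : ℝ) - ((η z).val : ℝ)) / (ϱ x * ((K : ℝ) - ϱ z))
    ∑ η : GCfg N d K, h η * (ω z η - ω x η) * f η * prodBinom ϱ η
      = (1 / (K : ℝ)) * ∑ η : GCfg N d K,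
          h η * s η * (f (cfgJump η x z) - f η) * prodBinom ϱ η
        - (ϱ z - ϱ x) * ∑ η : GCfg N d K,
            h η * f η * ω z η * ω x η * prodBinom ϱ η := by
  intro ω s
  have hsum := sum_cfgJump_eq ϱ hϱ hxz h hh f
  have hsplit : ∑ η : GCfg N d K, h η * s η * (f (cfgJump η x z) - f η) * prodBinom ϱ η
      = ∑ η : GCfg N d K, (h η * (((η z).val : ℝ) * ((K : ℝ) - ((η x).val : ℝ)) /
          (ϱ z * ((K : ℝ) - ϱ x))) * f η * prodBinom ϱ η
          - h η * s η * f η * prodBinom ϱ η) := by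
    rw [Finset.sum_sub_distrib, ← hsum, ← Finset.sum_sub_distrib]
    exact Finset.sum_congr rfl fun η _ => by ring
  rw [hsplit, Finset.mul_sum, Finset.mul_sum, ← Finset.sum_sub_distrib]
  refine Finset.sum_congr rfl fun η _ => ?_
  obtain ⟨ha, ha'⟩ := hϱ x
  obtain ⟨hb, hb'⟩ := hϱ z
  have hK0 : (K : ℝ) ≠ 0 := by linarith
  have ha'' : (K : ℝ) - ϱ x ≠ 0 := by linarith
  have hb'' : (K : ℝ) - ϱ z ≠ 0 := by linarith
  have hpoint : ω z η - ω x η = 1 / (K : ℝ) * (((η z).val : ℝ) * ((K : ℝ) - ((η x).val : ℝ)) /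
      (ϱ z * ((K : ℝ) - ϱ x)) - s η) - (ϱ z - ϱ x) * (ω z η * ω x η) := by
    simp only [ω, s]
    field_simp
    ring
  rw [hpoint]
  ring
end
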